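/- Let Ω ⊆ ℝⁿ be open and bounded, let g : ℝⁿ → ℝ be continuous, f : ℝⁿ → ℝ continuously differentiable, V : ℝⁿ → ℝⁿ continuously differentiable, and let φ : ℝⁿ → ℝⁿ be continuously differentiable with det Dφ(x) ≥ c for all x ∈ Ω, for some constant c > 0. Write φ_t = φ + t·(V∘φ), so that Dφ_t(x) = Dφ(x) + t·DV(φ(x))·Dφ(x). Then the pulled-back parameterization tracking functional t ↦ ½ ∫_Ω ( g(x)/det Dφ_t(x) − f(φ_t(x)) )² · det Dφ_t(x) dx is differentiable at t = 0 with derivative − ∫_Ω [ ½ ( g(x)²/(det Dφ(x))² − f(φ(x))² ) · (div V)(φ(x)) + ( g(x)/det Dφ(x) − f(φ(x)) ) · ⟨∇f(φ(x)), V(φ(x))⟩ ] · det Dφ(x) dx. -/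

import Mathlib

open MeasureTheory
open scoped RealInnerProductSpace

/-- The Jacobian matrix of a map `ψ : ℝⁿ → ℝⁿ` at `x`, i.e. the matrix of the
Fréchet derivative `Dψ(x)` in the standard basis. -/
noncomputable def jacMatrix {n : ℕ} (ψ : EuclideanSpace ℝ (Fin n) → EuclideanSpace ℝ (Fin n))
    (x : EuclideanSpace ℝ (Fin n)) : Matrix (Fin n) (Fin n) ℝ :=
  LinearMap.toMatrix (EuclideanSpace.basisFun (Fin n) ℝ).toBasis
    (EuclideanSpace.basisFun (Fin n) ℝ).toBasis (fderiv ℝ ψ x)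

open Topology Filter in
lemma aux_integral {E : Type*} [TopologicalSpace E] [T2Space E] [MeasurableSpace E] [BorelSpace E]
    [SecondCountableTopology E] [SecondCountableTopologyEither E ℝ]
    (μ : Measure E) [IsFiniteMeasureOnCompacts μ]
    (Ω K : Set E) (hΩ : IsOpen Ω) (hK : IsCompact K) (hΩK : Ω ⊆ K)
    (F F' : ℝ → E → ℝ) (ε : ℝ) (hε : 0 < ε)
    (hF : ContinuousOn (Function.uncurry F) (Metric.closedBall 0 ε ×ˢ K))
    (hF' : ContinuousOn (Function.uncurry F') (Metric.closedBall 0 ε ×ˢ K))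
    (hd : ∀ t ∈ Metric.closedBall (0 : ℝ) ε, ∀ x ∈ Ω, HasDerivAt (fun t => F t x) (F' t x) t) :
    HasDerivAt (fun t => ∫ x in Ω, F t x ∂μ) (∫ x in Ω, F' 0 x ∂μ) 0 := by
  have sl : ∀ G : ℝ → E → ℝ, ContinuousOn (Function.uncurry G) (Metric.closedBall 0 ε ×ˢ K) →
      ∀ t ∈ Metric.closedBall (0 : ℝ) ε, ContinuousOn (G t) K := by
    intro G hG t ht
    exact hG.comp (f := fun x => (t, x)) (by fun_prop) (fun x hx => ⟨ht, hx⟩)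
  have h0 : (0 : ℝ) ∈ Metric.closedBall (0 : ℝ) ε := by simp [hε.le]
  obtain ⟨C, hC⟩ := ((isCompact_closedBall (0 : ℝ) ε).prod hK).exists_bound_of_continuousOn hF'
  have hfin : IsFiniteMeasure (μ.restrict Ω) :=
    ⟨by simpa using (measure_mono hΩK).trans_lt hK.measure_lt_top⟩
  refine (hasDerivAt_integral_of_dominated_loc_of_deriv_le (bound := fun _ => C)
    (Metric.closedBall_mem_nhds (0 : ℝ) hε) ?_ ?_ ?_ ?_ (integrable_const C) ?_).2
  · filter_upwards [Metric.closedBall_mem_nhds (0 : ℝ) hε] with t ht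
    exact ((sl F hF t ht).mono hΩK).aestronglyMeasurable hΩ.measurableSet
  · exact ((sl F hF 0 h0).integrableOn_compact hK).mono_set hΩK
  · exact ((sl F' hF' 0 h0).mono hΩK).aestronglyMeasurable hΩ.measurableSet
  · filter_upwards [ae_restrict_mem hΩ.measurableSet] with x hx t ht
    exact hC (t, x) ⟨ht, hΩK hx⟩
  · filter_upwards [ae_restrict_mem hΩ.measurableSet] with x hx t ht
    exact hd t ht x hx

lemma aux_det (n : ℕ) : ∃ D' : ℝ → Matrix (Fin n) (Fin n) ℝ → Matrix (Fin n) (Fin n) ℝ → ℝ,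
    Continuous (fun p : ℝ × Matrix (Fin n) (Fin n) ℝ × Matrix (Fin n) (Fin n) ℝ =>
      D' p.1 p.2.1 p.2.2) ∧
    ∀ t A C, HasDerivAt (fun t : ℝ => (A + t • C).det) (D' t A C) t := by
  let d : (Fin n → Fin n → ℝ) → ℝ := fun M => (Matrix.of M).det
  have hd : ContDiff ℝ 1 d := by
    simp only [d, Matrix.det_apply, Matrix.of_apply]
    fun_prop
  have hfd : Continuous (fderiv ℝ d) := hd.continuous_fderiv one_ne_zero
  refine ⟨fun t A C => fderiv ℝ d (fun i j => A i j + t * C i j) (fun i j => C i j), ?_, ?_⟩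
  · refine (hfd.comp ?_).clm_apply ?_
    · refine continuous_pi fun i => continuous_pi fun j => ?_
      have h1 : Continuous fun p : ℝ × Matrix (Fin n) (Fin n) ℝ × Matrix (Fin n) (Fin n) ℝ =>
        p.2.1 i j := (continuous_fst.comp continuous_snd).matrix_elem i j
      have h2 : Continuous fun p : ℝ × Matrix (Fin n) (Fin n) ℝ × Matrix (Fin n) (Fin n) ℝ =>
        p.2.2 i j := (continuous_snd.comp continuous_snd).matrix_elem i j
      fun_prop
    · refine continuous_pi fun i => continuous_pi fun j => ?_
      exact (continuous_snd.comp continuous_snd).matrix_elem i j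
  · intro t A C
    have h := ((hd.differentiable one_ne_zero) (fun i j => A i j + t * C i j)).hasFDerivAt
    have h2 : HasDerivAt (fun t : ℝ => (fun i j => A i j + t * C i j : Fin n → Fin n → ℝ))
        (fun i j => C i j) t := by
      refine hasDerivAt_pi.2 fun i => hasDerivAt_pi.2 fun j => ?_
      simpa using ((hasDerivAt_id t).mul_const (C i j)).const_add (A i j)
    exact h.comp_hasDerivAt t h2

lemma aux_det_zero {n : ℕ} (A B : Matrix (Fin n) (Fin n) ℝ) :
    HasDerivAt (fun t : ℝ => (A + t • (B * A)).det) (B.trace * A.det) 0 := by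
  have e : (fun t : ℝ => (A + t • (B * A)).det) = fun t : ℝ =>
      (1 + B.trace * t + (Matrix.det (1 + (Polynomial.X : Polynomial ℝ) •
        B.map Polynomial.C)).divX.divX.eval t * t ^ 2) * A.det := by
    funext t
    rw [← Matrix.det_one_add_smul, ← Matrix.det_mul, add_mul, one_mul, Matrix.smul_mul]
  rw [e]
  have h1 := (Polynomial.hasDerivAt (Matrix.det (1 + (Polynomial.X : Polynomial ℝ) •
        B.map Polynomial.C)).divX.divX (0 : ℝ)).mul (hasDerivAt_pow 2 (0 : ℝ))
  have h2 := ((((hasDerivAt_id (0 : ℝ)).const_mul B.trace).const_add 1).add h1).mul_const A.det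
  convert! h2 using 1
  simp

lemma aux_jac {n : ℕ} {ψ : EuclideanSpace ℝ (Fin n) → EuclideanSpace ℝ (Fin n)}
    (h : ContDiff ℝ 1 ψ) : Continuous (jacMatrix ψ) := by
  have hfd : Continuous (fderiv ℝ ψ) := h.continuous_fderiv one_ne_zero
  refine continuous_matrix fun i j => ?_
  have : (fun x => jacMatrix ψ x i j) =
      fun x => (fderiv ℝ ψ x (EuclideanSpace.basisFun (Fin n) ℝ j)) i := by
    funext x
    simp [jacMatrix, LinearMap.toMatrix_apply]
  rw [this]
  fun_prop

/-- Pre-shape derivative of the (pulled-back) parameterization tracking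
functional in the codimension-zero case: with `φ_t = φ + t·(V∘φ)`, so that
`Dφ_t(x) = Dφ(x) + t·DV(φ(x))·Dφ(x)`, the map
`t ↦ ½ ∫_Ω (g/det Dφ_t − f∘φ_t)² det Dφ_t dx` is differentiable at `t = 0`
with the stated derivative. -/
theorem preshape_derivative_parameterization_tracking {n : ℕ}
    (Ω : Set (EuclideanSpace ℝ (Fin n))) (hΩ : IsOpen Ω) (hΩb : Bornology.IsBounded Ω)
    (g : EuclideanSpace ℝ (Fin n) → ℝ) (hg : Continuous g)
    (f : EuclideanSpace ℝ (Fin n) → ℝ) (hf : ContDiff ℝ 1 f)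
    (V : EuclideanSpace ℝ (Fin n) → EuclideanSpace ℝ (Fin n)) (hV : ContDiff ℝ 1 V)
    (φ : EuclideanSpace ℝ (Fin n) → EuclideanSpace ℝ (Fin n)) (hφ : ContDiff ℝ 1 φ)
    (c : ℝ) (hc : 0 < c) (hdet : ∀ x ∈ Ω, c ≤ (jacMatrix φ x).det) :
    HasDerivAt
      (fun t : ℝ => (1/2) * ∫ x in Ω,
        (g x / (jacMatrix φ x + t • (jacMatrix V (φ x) * jacMatrix φ x)).det
            - f (φ x + t • V (φ x)))^2
          * (jacMatrix φ x + t • (jacMatrix V (φ x) * jacMatrix φ x)).det)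
      (-∫ x in Ω,
        ((1/2) * (g x^2 / ((jacMatrix φ x).det)^2 - (f (φ x))^2)
            * (jacMatrix V (φ x)).trace
          + (g x / (jacMatrix φ x).det - f (φ x))
            * ⟪gradient f (φ x), V (φ x)⟫)
          * (jacMatrix φ x).det) 0 := by
  obtain ⟨D', hD'c, hD'⟩ := aux_det n
  have hJφ := aux_jac hφ
  have hJV := (aux_jac hV).comp hφ.continuous
  have hφc := hφ.continuous
  have hVc := hV.continuous
  have hfc := hf.continuous
  have hffc : Continuous (fderiv ℝ f) := hf.continuous_fderiv one_ne_zero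
  set A := jacMatrix φ with hA
  set B : EuclideanSpace ℝ (Fin n) → Matrix (Fin n) (Fin n) ℝ := fun x => jacMatrix V (φ x) with hB
  have hBc : Continuous B := hJV
  have hBA : Continuous fun x => B x * A x := hBc.matrix_mul hJφ
  set D : ℝ → EuclideanSpace ℝ (Fin n) → ℝ := fun t x => (A x + t • (B x * A x)).det with hD
  have hDc : Continuous fun p : ℝ × EuclideanSpace ℝ (Fin n) => D p.1 p.2 := by
    refine Continuous.matrix_det ?_
    exact (hJφ.comp continuous_snd).add (continuous_fst.smul (hBA.comp continuous_snd))
  set P : ℝ → EuclideanSpace ℝ (Fin n) → ℝ := fun t x => D' t (A x) (B x * A x) with hP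
  have hPc : Continuous fun p : ℝ × EuclideanSpace ℝ (Fin n) => P p.1 p.2 :=
    hD'c.comp (continuous_fst.prodMk
      ((hJφ.comp continuous_snd).prodMk (hBA.comp continuous_snd)))
  have hK : IsCompact (closure Ω) := hΩb.isCompact_closure
  have hcl : ∀ x ∈ closure Ω, c ≤ (A x).det := by
    have : closure Ω ⊆ {x | c ≤ (A x).det} :=
      closure_minimal hdet (isClosed_le continuous_const hJφ.matrix_det)
    exact this
  have hev : ∀ᶠ t in nhds (0 : ℝ), ∀ x ∈ closure Ω, 0 < D t x := by
    refine hK.eventually_forall_of_forall_eventually fun x hx => ?_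
    refine hDc.continuousAt.eventually_const_lt ?_
    simpa [hD] using hc.trans_le (hcl x hx)
  obtain ⟨ε, hε, hball⟩ := Metric.nhds_basis_closedBall.eventually_iff.1 hev
  let h : ℝ → EuclideanSpace ℝ (Fin n) → ℝ := fun t x => f (φ x + t • V (φ x))
  let h' : ℝ → EuclideanSpace ℝ (Fin n) → ℝ :=
    fun t x => fderiv ℝ f (φ x + t • V (φ x)) (V (φ x))
  have hhc : Continuous fun p : ℝ × EuclideanSpace ℝ (Fin n) => h p.1 p.2 := by
    simp only [h]; fun_prop
  have hh'c : Continuous fun p : ℝ × EuclideanSpace ℝ (Fin n) => h' p.1 p.2 := by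
    simp only [h']; fun_prop
  have hgc : Continuous fun p : ℝ × EuclideanSpace ℝ (Fin n) => g p.2 := by fun_prop
  have hhd : ∀ t x, HasDerivAt (fun t => h t x) (h' t x) t := by
    intro t x
    have h1 := ((hf.differentiable one_ne_zero) (φ x + t • V (φ x))).hasFDerivAt
    have h2 : HasDerivAt (fun t : ℝ => φ x + t • V (φ x)) (V (φ x)) t := by
      simpa using ((hasDerivAt_id t).smul_const (V (φ x))).const_add (φ x)
    exact h1.comp_hasDerivAt t h2
  have hne : ∀ p ∈ Metric.closedBall (0 : ℝ) ε ×ˢ closure Ω, D p.1 p.2 ≠ 0 :=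
    fun p hp => (hball hp.1 p.2 hp.2).ne'
  have key := aux_integral volume Ω (closure Ω) hΩ hK subset_closure
    (fun t x => (g x / D t x - h t x) ^ 2 * D t x)
    (fun t x => 2 * (g x / D t x - h t x) * (-(g x * P t x) / D t x ^ 2 - h' t x) * D t x
      + (g x / D t x - h t x) ^ 2 * P t x) ε hε ?_ ?_ ?_
  · have key2 := key.const_mul (1/2)
    refine key2.congr_deriv ?_
    rw [← integral_const_mul, ← integral_neg]
    refine setIntegral_congr_fun hΩ.measurableSet fun x hx => ?_
    have hd0 : (A x).det ≠ 0 := (hc.trans_le (hdet x hx)).ne'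
    have e1 : D 0 x = (A x).det := by simp [hD]
    have e2 : P 0 x = (B x).trace * (A x).det :=
      (hD' 0 (A x) (B x * A x)).unique (aux_det_zero (A x) (B x))
    have e3 : h 0 x = f (φ x) := by simp [h]
    have e4 : h' 0 x = ⟪gradient f (φ x), V (φ x)⟫ := by
      simp only [h', zero_smul, add_zero]
      rw [← toDual_gradient, InnerProductSpace.toDual_apply_apply]
    simp only [e1, e2, e3, e4]
    change _ = -(((1/2) * (g x^2 / ((A x).det)^2 - (f (φ x))^2) * (B x).trace
          + (g x / (A x).det - f (φ x)) * ⟪gradient f (φ x), V (φ x)⟫) * (A x).det)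
    generalize ⟪gradient f (φ x), V (φ x)⟫ = q
    field_simp
    ring
  · have hq := hgc.continuousOn.div hDc.continuousOn hne
    exact ((hq.sub hhc.continuousOn).pow 2).mul hDc.continuousOn
  · have hq := hgc.continuousOn.div hDc.continuousOn hne
    have hw := (hq.sub hhc.continuousOn)
    have hr := ((hgc.mul hPc).neg.continuousOn).div (hDc.pow 2).continuousOn
      (fun p hp => pow_ne_zero 2 (hne p hp))
    exact (((continuousOn_const.mul hw).mul (hr.sub hh'c.continuousOn)).mul hDc.continuousOn).add
      ((hw.pow 2).mul hPc.continuousOn)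
  · intro t ht x hx
    have hDd : HasDerivAt (fun t => D t x) (P t x) t := hD' t (A x) (B x * A x)
    have hD0 := hne (t, x) ⟨ht, subset_closure hx⟩
    have h1 := (((hasDerivAt_const t (g x)).div hDd hD0).sub (hhd t x)).pow 2 |>.mul hDd
    refine h1.congr_deriv ?_
    simp
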